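/- arXiv:2201.11023 — 4 statements merged into one kernel-verified Lean document; each statement's English description precedes it below -/
import Mathlib

section
/- Let T ⊂ ℝ^d be compact and let k be a universal kernel on T. Let σ : T → ℝ be continuous with 0 < m ≤ σ(s) ≤ M < ∞ for all s ∈ T and some constants m, M. Then the kernel q defined by q(s,t) = σ(s)σ(t)k(s,t) is also a universal kernel on T. -/
open scoped BigOperators

noncomputable section

/-- Euclidean space `ℝ^d`. -/
abbrev Euc (d : ℕ) : Type := EuclideanSpace ℝ (Fin d)

/-- A kernel on `T ⊂ ℝ^d`: a continuous, symmetric, positive semidefinite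
function `k : T × T → ℝ`. -/
def IsKernelOn {d : ℕ} (T : Set (Euc d)) (k : Euc d → Euc d → ℝ) : Prop :=
  ContinuousOn (fun p : Euc d × Euc d => k p.1 p.2) (T ×ˢ T) ∧
  (∀ s ∈ T, ∀ t ∈ T, k s t = k t s) ∧
  ∀ (n : ℕ) (x : Fin n → Euc d), (∀ i, x i ∈ T) →
    ∀ a : Fin n → ℝ, 0 ≤ ∑ i, ∑ j, a i * a j * k (x i) (x j)

/-- The kernel sections `k(·, t)` for `t ∈ T`, whose closed span is the RKHS `H(T)`. -/
def kernelSections {d : ℕ} (T : Set (Euc d)) (k : Euc d → Euc d → ℝ) : Set (Euc d → ℝ) :=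
  {f | ∃ t ∈ T, f = fun s => k s t}

/-- `k` is a universal kernel on `T`: its RKHS (the span of the kernel sections,
together with its limits) is dense in `(C(T), ‖·‖_∞)`, i.e. every continuous function
on `T` can be uniformly approximated to arbitrary precision. -/
def IsUniversalOn {d : ℕ} (T : Set (Euc d)) (k : Euc d → Euc d → ℝ) : Prop :=
  ∀ g : Euc d → ℝ, ContinuousOn g T → ∀ ε : ℝ, 0 < ε →
    ∃ f ∈ Submodule.span ℝ (kernelSections T k), ∀ s ∈ T, |f s - g s| < ε

theorem IsKernelOn.rescale {d : ℕ} {T : Set (Euc d)} {k : Euc d → Euc d → ℝ}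
    (hk : IsKernelOn T k) {σ : Euc d → ℝ} (hσ : ContinuousOn σ T) :
    IsKernelOn T (fun s t => σ s * σ t * k s t) := by
  obtain ⟨hcont, hsymm, hpos⟩ := hk
  refine ⟨?_, fun s hs t ht => ?_, fun n x hx a => ?_⟩
  · have h₁ : ContinuousOn (fun p : Euc d × Euc d => σ p.1) (T ×ˢ T) :=
      hσ.comp continuousOn_fst fun p hp => hp.1
    have h₂ : ContinuousOn (fun p : Euc d × Euc d => σ p.2) (T ×ˢ T) :=
      hσ.comp continuousOn_snd fun p hp => hp.2
    exact (h₁.mul h₂).mul hcont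
  · simp only [hsymm s hs t ht, mul_comm (σ s)]
  · refine (hpos n x hx (fun i => a i * σ (x i))).trans_eq
      (Finset.sum_congr rfl fun i _ => Finset.sum_congr rfl fun j _ => ?_)
    ring

theorem mul_mem_span_kernelSections_rescale {d : ℕ} {T : Set (Euc d)}
    {k : Euc d → Euc d → ℝ} {σ : Euc d → ℝ} (hσ : ∀ t ∈ T, σ t ≠ 0) {f : Euc d → ℝ}
    (hf : f ∈ Submodule.span ℝ (kernelSections T k)) :
    σ * f ∈ Submodule.span ℝ (kernelSections T (fun s t => σ s * σ t * k s t)) := by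
  induction hf using Submodule.span_induction with
  | mem f hf =>
    obtain ⟨t, ht, rfl⟩ := hf
    have h : (σ * fun s => k s t) = (σ t)⁻¹ • fun s => σ s * σ t * k s t := by
      funext s
      have := hσ t ht
      simp only [Pi.mul_apply, Pi.smul_apply, smul_eq_mul]
      field_simp
    rw [h]
    exact Submodule.smul_mem _ _ (Submodule.subset_span ⟨t, ht, rfl⟩)
  | zero => simp
  | add f g _ _ hf hg => rw [mul_add]; exact add_mem hf hg
  | smul c f _ hf => rw [mul_smul_comm]; exact Submodule.smul_mem _ c hf

theorem IsUniversalOn.rescale {d : ℕ} {T : Set (Euc d)} {k : Euc d → Euc d → ℝ}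
    (hk : IsUniversalOn T k) {σ : Euc d → ℝ} (hσ : ContinuousOn σ T) {M : ℝ}
    (hpos : ∀ s ∈ T, 0 < σ s) (hM : ∀ s ∈ T, σ s ≤ M) :
    IsUniversalOn T (fun s t => σ s * σ t * k s t) := by
  intro g hg ε hε
  have hne : ∀ s ∈ T, σ s ≠ 0 := fun s hs => (hpos s hs).ne'
  have hM' : 0 < max M 1 := lt_max_of_lt_right one_pos
  obtain ⟨f, hf, hfg⟩ := hk (fun s => g s / σ s) (hg.div hσ hne) (ε / max M 1) (by positivity)
  refine ⟨σ * f, mul_mem_span_kernelSections_rescale hne hf, fun s hs => ?_⟩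
  have heq : (σ * f) s - g s = σ s * (f s - g s / σ s) := by
    rw [Pi.mul_apply, mul_sub, mul_div_cancel₀ _ (hne s hs)]
  calc |(σ * f) s - g s| = σ s * |f s - g s / σ s| := by
        rw [heq, abs_mul, abs_of_pos (hpos s hs)]
    _ < σ s * (ε / max M 1) := mul_lt_mul_of_pos_left (hfg s hs) (hpos s hs)
    _ ≤ max M 1 * (ε / max M 1) := by
        gcongr
        exact (hM s hs).trans (le_max_left _ _)
    _ = ε := mul_div_cancel₀ _ hM'.ne'

/-- If `k` is a universal kernel on the compact set `T ⊂ ℝ^d` and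
`σ : T → ℝ` is continuous with `0 < m ≤ σ(s) ≤ M < ∞` on `T`, then
`q(s,t) = σ(s)σ(t)k(s,t)` is also a universal kernel on `T`. -/
theorem statement0 {d : ℕ} (T : Set (Euc d)) (hT : IsCompact T)
    (k : Euc d → Euc d → ℝ) (hk : IsKernelOn T k) (hku : IsUniversalOn T k)
    (σ : Euc d → ℝ) (hσ : ContinuousOn σ T)
    (m M : ℝ) (hm : 0 < m)
    (hbound : ∀ s ∈ T, m ≤ σ s ∧ σ s ≤ M) :
    IsKernelOn T (fun s t => σ s * σ t * k s t) ∧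
    IsUniversalOn T (fun s t => σ s * σ t * k s t) := by
  exact ⟨hk.rescale hσ, hku.rescale hσ (fun s hs => hm.trans_le (hbound s hs).1)
    fun s hs => (hbound s hs).2⟩
end
end

section
/- Let T ⊂ ℝ^d be compact, T_0 ⊂ T, and let k be a γ-Hölder continuous kernel on T that is universal on T_0, with g|_{T_0}, μ|_{T_0} ∈ H(T_0). Let D = {t_n} ⊂ T_0 be countable and dense in T_0, let Q_N be the orthogonal projection in H(T_0) onto span{k_{t_1}|_{T_0}, ..., k_{t_N}|_{T_0}}, and define μ_0^N(s) = μ(s) + ⟨Q_N(k_s|_{T_0}), Q_N((g−μ)|_{T_0})⟩_{H(T_0)} and k_0^N(s,t) = k(s,t) − ⟨Q_N(k_s|_{T_0}), Q_N(k_t|_{T_0})⟩_{H(T_0)}. Then the sequence of continuous-path Gaussian processes X^N with mean μ_0^N and covariance k_0^N is tight in (C(T), ‖·‖_∞). -/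
open MeasureTheory ProbabilityTheory
open scoped BigOperators RealInnerProductSpace

noncomputable section

/-- `X` is a Gaussian process on `(Ω, P)` with mean function `μ` and covariance kernel `c`. -/
def IsGaussianProcess {Ω ι : Type*} [MeasurableSpace Ω] (P : Measure Ω)
    (X : ι → Ω → ℝ) (μ : ι → ℝ) (c : ι → ι → ℝ) : Prop :=
  ∀ (n : ℕ) (t : Fin n → ι) (a : Fin n → ℝ),
    P.map (fun ω => ∑ i, a i * X (t i) ω) =
      gaussianReal (∑ i, a i * μ (t i))
        (∑ i, ∑ j, a i * a j * c (t i) (t j)).toNNReal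

/-- Gaussian tail bound with a variance proxy `c ≥ v`. -/
lemma measure_lt_abs_sub_le_of_map_eq_gaussianReal {Ω : Type*} [MeasurableSpace Ω]
    {P : Measure Ω} {Y : Ω → ℝ} {m c l : ℝ} {v : NNReal}
    (hY : P.map Y = gaussianReal m v) (hv : (v : ℝ) ≤ c) (hl : 0 ≤ l) :
    P {ω | l < |Y ω - m|} ≤ ENNReal.ofReal (2 * Real.exp (-l ^ 2 / (2 * c))) := by
  have hYm : AEMeasurable Y P := aemeasurable_of_map_neZero (by rw [hY]; infer_instance)
  have : IsProbabilityMeasure P := by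
    have : IsProbabilityMeasure (P.map Y) := by rw [hY]; infer_instance
    exact Measure.isProbabilityMeasure_of_map Y
  have hc : 0 ≤ c := v.2.trans hv
  have hZ : P.map (fun ω => Y ω - m) = gaussianReal 0 v := by
    have h := AEMeasurable.map_map_of_aemeasurable (μ := P) (f := Y) (g := fun y : ℝ => y - m)
      (by fun_prop) hYm
    rw [hY, gaussianReal_map_sub_const, sub_self] at h
    exact h.symm
  have hsub : HasSubgaussianMGF (fun ω => Y ω - m) ⟨c, hc⟩ P := by
    refine ⟨fun t => ?_, fun t => ?_⟩
    · have h := integrable_exp_mul_gaussianReal (μ := 0) (v := v) t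
      rw [← hZ] at h
      exact h.comp_aemeasurable (f := fun ω => Y ω - m) (by fun_prop)
    · rw [mgf_gaussianReal hZ]
      gcongr
      simp only [zero_mul, zero_add]
      gcongr
      exact hv
  have h1 := hsub.measure_ge_le hl
  have h2 := hsub.neg.measure_ge_le hl
  have hsubset : {ω | l < |Y ω - m|} ⊆
      {ω | l ≤ Y ω - m} ∪ {ω | l ≤ (-fun ω => Y ω - m) ω} := by
    intro ω hω
    rcases lt_abs.1 (show l < |Y ω - m| from hω) with h | h
    · exact Or.inl h.le
    · exact Or.inr h.le
  have h3 := (measureReal_mono (μ := P) hsubset).trans (measureReal_union_le _ _)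
  rw [← ofReal_measureReal (μ := P)]
  refine ENNReal.ofReal_le_ofReal (h3.trans ?_)
  rw [two_mul]
  exact add_le_add h1 h2

/-- Chaining: control of the increments of a continuous function between consecutive dyadic nets
gives a modulus of continuity. -/
lemma abs_sub_le_of_dyadic_nets {S : Type*} [PseudoMetricSpace S] {net : ℕ → Finset S}
    (hnet : ∀ n x, ∃ y ∈ net n, dist x y ≤ (1 / 2 : ℝ) ^ n)
    {r : ℝ} (hr0 : 0 < r) (hr1 : r < 1) {f : S → ℝ} (hf : Continuous f) {n₀ : ℕ}
    (h : ∀ n ≥ n₀, ∀ u ∈ net n, ∀ v ∈ net (n + 1), dist u v ≤ 3 * (1 / 2 : ℝ) ^ n →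
      |f u - f v| ≤ r ^ n)
    {n : ℕ} (hn : n₀ ≤ n) {s t : S} (hst : dist s t ≤ (1 / 2 : ℝ) ^ n) :
    |f s - f t| ≤ (2 / (1 - r) + 1) * r ^ n := by
  choose p hp hpd using hnet
  have hr : 0 < 1 - r := by linarith
  have hhalf : ∀ m : ℕ, (0 : ℝ) < (1 / 2) ^ m := fun m => by positivity
  have hlim : ∀ x, Filter.Tendsto (fun m => p m x) Filter.atTop (nhds x) := by
    intro x
    rw [tendsto_iff_dist_tendsto_zero]
    refine squeeze_zero (fun _ => dist_nonneg) (fun m => ?_)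
      (tendsto_pow_atTop_nhds_zero_of_lt_one (r := (1 / 2 : ℝ)) (by norm_num) (by norm_num))
    rw [dist_comm]
    exact hpd m x
  have key : ∀ m ≥ n₀, ∀ x, |f (p m x) - f x| ≤ r ^ m / (1 - r) := by
    intro m hm x
    have hl : Filter.Tendsto (fun j => f (p (j + m) x)) Filter.atTop (nhds (f x)) :=
      (hf.tendsto x).comp ((hlim x).comp (Filter.tendsto_add_atTop_nat m))
    have := dist_le_of_le_geometric_of_tendsto₀ r (r ^ m) hr1 (f := fun j => f (p (j + m) x))
      (fun j => ?_) hl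
    · simpa [Real.dist_eq] using this
    · rw [Real.dist_eq, ← pow_add, add_comm m j, show j + 1 + m = j + m + 1 by ring]
      refine h _ (by omega) _ (hp _ _) _ (hp _ _) ?_
      have h1 := hpd (j + m) x
      have h2 := hpd (j + m + 1) x
      have h3 := dist_triangle_left (p (j + m) x) (p (j + m + 1) x) x
      have h4 := hhalf (j + m)
      rw [pow_succ] at h2
      linarith
  have h1 := key n hn s
  have h2 := key (n + 1) (by omega) t
  have h3 : |f (p n s) - f (p (n + 1) t)| ≤ r ^ n := by
    refine h n hn _ (hp _ _) _ (hp _ _) ?_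
    have h1 := hpd n s
    have h2 := hpd (n + 1) t
    have h3 := dist_triangle4 (p n s) s t (p (n + 1) t)
    have h4 := hhalf n
    rw [pow_succ] at h2
    rw [dist_comm] at h1
    linarith
  have h4 : r ^ (n + 1) / (1 - r) ≤ r ^ n / (1 - r) := by
    gcongr ?_ / _
    exact pow_le_pow_of_le_one hr0.le hr1.le (by omega)
  have h5 : (2 / (1 - r) + 1) * r ^ n = r ^ n / (1 - r) + r ^ n / (1 - r) + r ^ n := by ring
  rw [h5]
  rw [abs_le] at *
  constructor <;> linarith [h1.1, h1.2, h2.1, h2.2, h3.1, h3.2]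

/-- A bounded subset of Euclidean space has dyadic nets of exponential cardinality. -/
lemma exists_dyadic_nets {d : ℕ} {T : Set (Euc d)} (hT : Bornology.IsBounded T) :
    ∃ (A : ℕ) (net : ℕ → Finset T), (∀ n, (net n).card ≤ A ^ (n + 1)) ∧
      ∀ n x, ∃ y ∈ net n, dist x y ≤ (1 / 2 : ℝ) ^ n := by
  classical
  obtain ⟨R₀, hR₀⟩ := hT.exists_norm_le
  obtain ⟨R, hR⟩ := exists_nat_ge (max R₀ 1)
  have hR1 : 1 ≤ R := by exact_mod_cast (le_max_right R₀ 1).trans hR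
  have hRT : ∀ x ∈ T, ‖x‖ ≤ R := fun x hx => (hR₀ x hx).trans ((le_max_left _ _).trans hR)
  let cell : ℕ → T → Fin d → ℤ := fun n x i => ⌊(x : Euc d) i * ((d + 1) * 2 ^ n)⌋
  let L : ℕ → ℕ := fun n => R * ((d + 1) * 2 ^ n)
  have hcell : ∀ n x, cell n x ∈
      Fintype.piFinset (fun _ : Fin d => Finset.Icc (-(L n : ℤ)) (L n)) := by
    intro n x
    rw [Fintype.mem_piFinset]
    intro i
    have h1 : |(x : Euc d) i| ≤ R :=
      (PiLp.norm_apply_le (x : Euc d) i).trans (hRT x x.2)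
    rw [abs_le] at h1
    have hpos : (0 : ℝ) ≤ (d + 1) * 2 ^ n := by positivity
    rw [Finset.mem_Icc]
    constructor
    · refine Int.le_floor.2 ?_
      push_cast [L]
      nlinarith [h1.1]
    · refine Int.floor_le_iff.2 ?_
      push_cast [L]
      nlinarith [h1.2]
  have hnet : ∀ n, ∃ N : Finset T,
      N.card ≤ (Fintype.piFinset (fun _ : Fin d => Finset.Icc (-(L n : ℤ)) (L n))).card ∧
      ∀ x, ∃ y ∈ N, cell n x = cell n y := by
    intro n
    obtain ⟨s, -, hs⟩ := Set.exists_subset_bijOn (Set.univ : Set T) (cell n)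
    have hmaps : Set.MapsTo (cell n) s
        (Fintype.piFinset (fun _ : Fin d => Finset.Icc (-(L n : ℤ)) (L n))) :=
      fun x _ => hcell n x
    have hsf : s.Finite := Set.Finite.of_injOn hmaps hs.injOn (Finset.finite_toSet _)
    refine ⟨hsf.toFinset, Finset.card_le_card_of_injOn (cell n) (fun x _ => hcell n x)
      (by simpa using hs.injOn), fun x => ?_⟩
    obtain ⟨y, hy, hxy⟩ := hs.surjOn (Set.mem_image_of_mem (cell n) (Set.mem_univ x))
    exact ⟨y, by simpa using hy, hxy.symm⟩
  choose net hcard hcover using hnet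
  refine ⟨(3 * R * (d + 1) * 2) ^ d, net, fun n => (hcard n).trans ?_, fun n x => ?_⟩
  · rw [Fintype.card_piFinset_const, Int.card_Icc, ← pow_mul, mul_comm d, pow_mul]
    gcongr
    have h1 : ((L n : ℤ) + 1 - -(L n : ℤ)).toNat = 2 * L n + 1 := by omega
    have h2 : 1 ≤ L n := Nat.one_le_iff_ne_zero.2 (by positivity)
    have h3 : L n ≤ R ^ (n + 1) * ((d + 1) ^ (n + 1) * 2 ^ (n + 1)) := by
      refine Nat.mul_le_mul (Nat.le_self_pow (by omega) R)
        (Nat.mul_le_mul (Nat.le_self_pow (by omega) _) (Nat.pow_le_pow_right (by omega) (by omega)))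
    have h4 : (3 : ℕ) ≤ 3 ^ (n + 1) := Nat.le_self_pow (by omega) 3
    rw [h1, mul_pow, mul_pow, mul_pow]
    calc 2 * L n + 1 ≤ 3 * L n := by omega
      _ ≤ 3 ^ (n + 1) * (R ^ (n + 1) * ((d + 1) ^ (n + 1) * 2 ^ (n + 1))) :=
        Nat.mul_le_mul h4 h3
      _ = _ := by ring
  · obtain ⟨y, hy, hxy⟩ := hcover n x
    refine ⟨y, hy, ?_⟩
    have hpos : (0 : ℝ) < (d + 1) * 2 ^ n := by positivity
    have hcoord : ∀ i, dist ((x : Euc d) i) ((y : Euc d) i) ≤ 1 / ((d + 1) * 2 ^ n) := by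
      intro i
      have h := Int.abs_sub_lt_one_of_floor_eq_floor (congrFun hxy i)
      rw [← sub_mul, abs_mul, abs_of_pos hpos] at h
      rw [Real.dist_eq, le_div_iff₀ hpos]
      exact h.le
    rw [Subtype.dist_eq, EuclideanSpace.dist_eq, Real.sqrt_le_left (by positivity)]
    calc ∑ i, dist ((x : Euc d) i) ((y : Euc d) i) ^ 2
        ≤ ∑ _i : Fin d, (1 / ((d + 1 : ℝ) * 2 ^ n)) ^ 2 := by
          gcongr with i
          exact hcoord i
      _ = d / (d + 1 : ℝ) ^ 2 * ((1 / 2 : ℝ) ^ n) ^ 2 := by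
          simp only [Finset.sum_const, Finset.card_univ, Fintype.card_fin, nsmul_eq_mul,
            one_div, mul_inv, mul_pow, inv_pow]
          ring
      _ ≤ 1 * ((1 / 2 : ℝ) ^ n) ^ 2 := by
          gcongr
          rw [div_le_one (by positivity)]
          nlinarith [(Nat.cast_nonneg d : (0 : ℝ) ≤ d)]
      _ = _ := one_mul _

/-- Gaussian tails beat the exponential growth of the number of pairs in consecutive nets. -/
lemma summable_pow_mul_exp_neg {A : ℝ} (hA : 0 ≤ A) {K r : ℝ} (hK : 0 < K) (hr0 : 0 < r)
    (hr1 : r < 1) :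
    Summable fun n : ℕ => A ^ (n + 1) * A ^ (n + 2) *
      (2 * Real.exp (-(r ^ n) ^ 2 / (2 * (K * (r ^ 4) ^ n)))) := by
  have hlim : Filter.Tendsto (fun m : ℕ => A ^ 2 * (r ^ 2) ^ m) Filter.atTop (nhds (A ^ 2 * 0)) :=
    (tendsto_pow_atTop_nhds_zero_of_lt_one (by positivity)
      (pow_lt_one₀ hr0.le hr1 two_ne_zero)).const_mul _
  rw [mul_zero] at hlim
  obtain ⟨m, hm⟩ := (hlim.eventually_lt_const one_pos).exists
  have hgeo := (summable_geometric_of_lt_one (by positivity) hm).mul_left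
    (2 * A ^ 3 * (m.factorial * (2 * K) ^ m))
  refine Summable.of_nonneg_of_le (fun n => by positivity) (fun n => ?_) hgeo
  have hx : 0 < 1 / (2 * K * (r ^ n) ^ 2) := by positivity
  have h1 : -(r ^ n) ^ 2 / (2 * (K * (r ^ 4) ^ n)) = -(1 / (2 * K * (r ^ n) ^ 2)) := by
    have : (r ^ 4) ^ n = (r ^ n) ^ 4 := by ring
    rw [this]
    field_simp
  have h2 : Real.exp (-(1 / (2 * K * (r ^ n) ^ 2))) ≤
      m.factorial * (2 * K * (r ^ n) ^ 2) ^ m := by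
    rw [Real.exp_neg]
    have h3 := Real.pow_div_factorial_le_exp _ hx.le m
    have h4 : 0 < (1 / (2 * K * (r ^ n) ^ 2)) ^ m / m.factorial := by positivity
    calc _ ≤ ((1 / (2 * K * (r ^ n) ^ 2)) ^ m / m.factorial)⁻¹ := by gcongr
      _ = _ := by
        rw [inv_div, div_pow, one_pow, one_div, div_inv_eq_mul]
  rw [h1]
  calc _ ≤ A ^ (n + 1) * A ^ (n + 2) * (2 * (m.factorial * (2 * K * (r ^ n) ^ 2) ^ m)) := by
        gcongr
    _ = _ := by ring

/-- A family of functions whose deviations from a uniformly bounded, uniformly equicontinuous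
family have a common modulus of continuity and are bounded is relatively compact. -/
lemma isCompact_closure_of_dyadic_modulus {S ι : Type*} [PseudoMetricSpace S] [CompactSpace S]
    {m : ι → S → ℝ} (hm : UniformEquicontinuous m)
    {n₀ : ℕ} {w : ℕ → ℝ} (hw : Filter.Tendsto w Filter.atTop (nhds 0)) (R : ℝ) :
    IsCompact (closure {f : BoundedContinuousFunction S ℝ | (∀ x, |f x| ≤ R) ∧
      ∃ i, ∀ n ≥ n₀, ∀ s t, dist s t ≤ (1 / 2 : ℝ) ^ n →
        |(f s - m i s) - (f t - m i t)| ≤ w n}) := by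
  refine BoundedContinuousFunction.arzela_ascoli (Set.Icc (-R) R) isCompact_Icc _
    (fun f x hf => abs_le.1 (hf.1 x)) (UniformEquicontinuous.equicontinuous ?_)
  rw [Metric.uniformEquicontinuous_iff] at hm ⊢
  intro ε hε
  obtain ⟨δ, hδ, hmδ⟩ := hm (ε / 2) (half_pos hε)
  obtain ⟨n, hnw, hn⟩ := ((hw.eventually_lt_const (half_pos hε)).and
    (Filter.eventually_ge_atTop n₀)).exists
  refine ⟨min δ ((1 / 2 : ℝ) ^ n), lt_min hδ (by positivity), fun s t hst f => ?_⟩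
  obtain ⟨i, hi⟩ := f.2.2
  have h1 := hi n hn s t (hst.le.trans (min_le_right _ _))
  have h2 := hmδ s t (hst.trans_le (min_le_left _ _)) i
  rw [Real.dist_eq] at h2 ⊢
  rw [abs_le] at h1
  rw [abs_lt] at h2 ⊢
  constructor <;> linarith [h1.1, h1.2, h2.1, h2.2]

/-- Tightness criterion for continuous Gaussian processes on a space with nets of exponential
cardinality: bounded equicontinuous means, bounded variances, and Hölder increment variances. -/
theorem exists_isCompact_forall_ofReal_le_of_gaussian {S ι Ω : Type*} [PseudoMetricSpace S]
    [CompactSpace S] {A : ℕ} {net : ℕ → Finset S} (hcard : ∀ n, (net n).card ≤ A ^ (n + 1))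
    (hnet : ∀ n x, ∃ y ∈ net n, dist x y ≤ (1 / 2 : ℝ) ^ n)
    [MeasurableSpace Ω] {P : Measure Ω} [IsProbabilityMeasure P]
    {X : ι → Ω → BoundedContinuousFunction S ℝ} {m : ι → S → ℝ} (hm : UniformEquicontinuous m)
    {M : ℝ} (hM : ∀ i s, |m i s| ≤ M) {γ K V : ℝ} (hγ : 0 < γ) (hK : 0 < K) (hV : 0 < V)
    (hX : ∀ i s, ∃ v : NNReal, (v : ℝ) ≤ V ∧ P.map (fun ω => X i ω s) = gaussianReal (m i s) v)
    (hXX : ∀ i s t, ∃ v : NNReal, (v : ℝ) ≤ K * dist s t ^ γ ∧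
      P.map (fun ω => X i ω s - X i ω t) = gaussianReal (m i s - m i t) v)
    {ε : ℝ} (hε : 0 < ε) :
    ∃ C : Set (BoundedContinuousFunction S ℝ), IsCompact C ∧
      ∀ i, ENNReal.ofReal (1 - ε) ≤ P {ω | X i ω ∈ C} := by
  set r : ℝ := (1 / 2 : ℝ) ^ (γ / 4) with hr
  have hr0 : 0 < r := by positivity
  have hr1 : r < 1 := Real.rpow_lt_one (by norm_num) (by norm_num) (by positivity)
  have hr4 : ∀ n : ℕ, (3 * (1 / 2 : ℝ) ^ n) ^ γ = 3 ^ γ * (r ^ 4) ^ n := by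
    intro n
    rw [Real.mul_rpow (by norm_num) (by positivity), hr, ← Real.rpow_natCast, ← Real.rpow_natCast,
      ← Real.rpow_natCast, ← Real.rpow_mul (by positivity), ← Real.rpow_mul (by positivity),
      ← Real.rpow_mul (by positivity)]
    congr 2
    push_cast
    ring
  set K' : ℝ := K * 3 ^ γ with hK'
  have hK'0 : 0 < K' := by positivity
  set b : ℕ → ℝ := fun n => (A : ℝ) ^ (n + 1) * (A : ℝ) ^ (n + 2) *
      (2 * Real.exp (-(r ^ n) ^ 2 / (2 * (K' * (r ^ 4) ^ n)))) with hb
  have hbsum : Summable b := summable_pow_mul_exp_neg (Nat.cast_nonneg A) hK'0 hr0 hr1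
  have hb0 : ∀ n, 0 ≤ b n := fun n => by positivity
  obtain ⟨n₀, hn₀⟩ := ((tendsto_sum_nat_add b).eventually_lt_const (half_pos hε)).exists
  have htail : Filter.Tendsto
      (fun R : ℝ => (net n₀).card * (2 * Real.exp (-R ^ 2 / (2 * V)))) Filter.atTop
      (nhds ((net n₀).card * (2 * 0))) := by
    refine (Filter.Tendsto.const_mul _ (Filter.Tendsto.const_mul _
      (Real.tendsto_exp_atBot.comp ?_)))
    simp only [neg_div]
    exact Filter.tendsto_neg_atTop_atBot.comp
      ((Filter.tendsto_pow_atTop two_ne_zero).atTop_div_const (by positivity))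
  rw [mul_zero, mul_zero] at htail
  obtain ⟨R, hRε, hR0⟩ := ((htail.eventually_lt_const (half_pos hε)).and
    (Filter.eventually_ge_atTop 0)).exists
  set c : ℝ := 2 / (1 - r) + 1 with hc
  have hw : Filter.Tendsto (fun n => c * r ^ n) Filter.atTop (nhds 0) := by
    simpa using (tendsto_pow_atTop_nhds_zero_of_lt_one hr0.le hr1).const_mul c
  refine ⟨_, isCompact_closure_of_dyadic_modulus hm (n₀ := n₀) hw (R + c * r ^ n₀ + M),
    fun i => ?_⟩
  set bad₁ : Set Ω := ⋃ n : ℕ, ⋃ u ∈ net (n + n₀), ⋃ v ∈ net (n + n₀ + 1),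
    {ω | dist u v ≤ 3 * (1 / 2 : ℝ) ^ (n + n₀) ∧
      r ^ (n + n₀) < |X i ω u - X i ω v - (m i u - m i v)|} with hbad₁
  set bad₂ : Set Ω := ⋃ u ∈ net n₀, {ω | R < |X i ω u - m i u|} with hbad₂
  have hP₁ : P bad₁ ≤ ENNReal.ofReal (ε / 2) := by
    have hpair : ∀ n u v, P {ω | dist u v ≤ 3 * (1 / 2 : ℝ) ^ n ∧
        r ^ n < |X i ω u - X i ω v - (m i u - m i v)|} ≤
        ENNReal.ofReal (2 * Real.exp (-(r ^ n) ^ 2 / (2 * (K' * (r ^ 4) ^ n)))) := by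
      intro n u v
      by_cases huv : dist u v ≤ 3 * (1 / 2 : ℝ) ^ n
      · obtain ⟨σ, hσ, hlaw⟩ := hXX i u v
        simp only [huv, true_and]
        refine measure_lt_abs_sub_le_of_map_eq_gaussianReal hlaw (hσ.trans ?_) (by positivity)
        rw [hK', mul_assoc, ← hr4]
        gcongr
      · simp only [huv, false_and, Set.ofPred_false, measure_empty, zero_le]
    calc P bad₁ ≤ ∑' n : ℕ, ∑ u ∈ net (n + n₀), ∑ v ∈ net (n + n₀ + 1), _ :=
          (measure_iUnion_le _).trans (ENNReal.tsum_le_tsum fun n =>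
            (measure_biUnion_finset_le _ _).trans (Finset.sum_le_sum fun u _ =>
              (measure_biUnion_finset_le _ _).trans (Finset.sum_le_sum fun v _ =>
                hpair (n + n₀) u v)))
      _ ≤ ∑' n : ℕ, ENNReal.ofReal (b (n + n₀)) := by
          refine ENNReal.tsum_le_tsum fun n => ?_
          simp only [Finset.sum_const, nsmul_eq_mul]
          rw [← mul_assoc, ← Nat.cast_mul, ← ENNReal.ofReal_natCast,
            ← ENNReal.ofReal_mul (Nat.cast_nonneg _)]
          refine ENNReal.ofReal_le_ofReal ?_
          rw [hb]
          push_cast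
          rw [← Nat.cast_pow, ← Nat.cast_pow]
          gcongr
          · exact hcard _
          · exact hcard _
      _ = ENNReal.ofReal (∑' n : ℕ, b (n + n₀)) :=
          (ENNReal.ofReal_tsum_of_nonneg (fun n => hb0 _)
            ((summable_nat_add_iff n₀).2 hbsum)).symm
      _ ≤ _ := ENNReal.ofReal_le_ofReal hn₀.le
  have hP₂ : P bad₂ ≤ ENNReal.ofReal (ε / 2) := by
    calc P bad₂ ≤ ∑ u ∈ net n₀, ENNReal.ofReal (2 * Real.exp (-R ^ 2 / (2 * V))) := by
          refine (measure_biUnion_finset_le _ _).trans (Finset.sum_le_sum fun u _ => ?_)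
          obtain ⟨σ, hσ, hlaw⟩ := hX i u
          exact measure_lt_abs_sub_le_of_map_eq_gaussianReal hlaw hσ hR0
      _ = ENNReal.ofReal ((net n₀).card * (2 * Real.exp (-R ^ 2 / (2 * V)))) := by
          rw [Finset.sum_const, nsmul_eq_mul, ENNReal.ofReal_mul (Nat.cast_nonneg _),
            ENNReal.ofReal_natCast]
      _ ≤ _ := ENNReal.ofReal_le_ofReal hRε.le
  have hgood : (bad₁ ∪ bad₂)ᶜ ⊆ {ω | X i ω ∈ closure {f : BoundedContinuousFunction S ℝ |
      (∀ x, |f x| ≤ R + c * r ^ n₀ + M) ∧ ∃ i, ∀ n ≥ n₀, ∀ s t, dist s t ≤ (1 / 2 : ℝ) ^ n →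
        |(f s - m i s) - (f t - m i t)| ≤ c * r ^ n}} := by
    intro ω hω
    rw [Set.compl_union] at hω
    have h₁ : ∀ n ≥ n₀, ∀ u ∈ net n, ∀ v ∈ net (n + 1), dist u v ≤ 3 * (1 / 2 : ℝ) ^ n →
        |(X i ω u - m i u) - (X i ω v - m i v)| ≤ r ^ n := by
      intro n hn u hu v hv huv
      obtain ⟨j, rfl⟩ := Nat.exists_eq_add_of_le' hn
      by_contra hlt
      refine hω.1 ?_
      simp only [hbad₁, Set.mem_iUnion]
      refine ⟨j, u, hu, v, hv, huv, ?_⟩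
      rw [sub_sub_sub_comm]
      exact not_le.1 hlt
    have h₂ : ∀ u ∈ net n₀, |X i ω u - m i u| ≤ R := by
      intro u hu
      by_contra hlt
      refine hω.2 ?_
      simp only [hbad₂, Set.mem_iUnion]
      exact ⟨u, hu, not_le.1 hlt⟩
    have hcont : Continuous fun s => X i ω s - m i s :=
      (X i ω).continuous.sub (hm.uniformContinuous i).continuous
    have hmod : ∀ n ≥ n₀, ∀ s t, dist s t ≤ (1 / 2 : ℝ) ^ n →
        |(X i ω s - m i s) - (X i ω t - m i t)| ≤ c * r ^ n := fun n hn s t hst =>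
      abs_sub_le_of_dyadic_nets hnet hr0 hr1 hcont h₁ hn hst
    refine subset_closure ⟨fun x => ?_, i, hmod⟩
    obtain ⟨y, hy, hxy⟩ := hnet n₀ x
    have h3 := hmod n₀ le_rfl x y hxy
    have h4 := h₂ y hy
    have h5 := hM i x
    rw [abs_le] at *
    constructor <;> linarith [h3.1, h3.2, h4.1, h4.2, h5.1, h5.2]
  have hbad : P (bad₁ ∪ bad₂) ≤ ENNReal.ofReal ε := by
    refine (measure_union_le _ _).trans ((add_le_add hP₁ hP₂).trans_eq ?_)
    rw [← ENNReal.ofReal_add (by positivity) (by positivity), add_halves]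
  rw [ENNReal.ofReal_sub _ hε.le, ENNReal.ofReal_one, tsub_le_iff_right]
  calc 1 = P Set.univ := measure_univ.symm
    _ ≤ P ((bad₁ ∪ bad₂)ᶜ) + P (bad₁ ∪ bad₂) := by
        rw [← Set.compl_union_self (bad₁ ∪ bad₂)]
        exact measure_union_le _ _
    _ ≤ _ := add_le_add (measure_mono hgood) hbad

/-- The increments of a Gaussian process are Gaussian. -/
lemma IsGaussianProcess.map_sub {Ω ι : Type*} [MeasurableSpace Ω] {P : Measure Ω}
    {X : ι → Ω → ℝ} {μ : ι → ℝ} {c : ι → ι → ℝ} (hX : IsGaussianProcess P X μ c) (s t : ι) :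
    P.map (fun ω => X s ω - X t ω) =
      gaussianReal (μ s - μ t) (c s s - c s t - c t s + c t t).toNNReal := by
  have h := hX 2 ![s, t] ![1, -1]
  simp only [Fin.sum_univ_two, Matrix.cons_val_zero, Matrix.cons_val_one] at h
  convert h using 2
  · ext ω
    ring
  · ring
  · congr 1
    ring

/-- The marginals of a Gaussian process are Gaussian. -/
lemma IsGaussianProcess.map_eval {Ω ι : Type*} [MeasurableSpace Ω] {P : Measure Ω}
    {X : ι → Ω → ℝ} {μ : ι → ℝ} {c : ι → ι → ℝ} (hX : IsGaussianProcess P X μ c) (s : ι) :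
    P.map (X s) = gaussianReal (μ s) (c s s).toNNReal := by
  simpa using hX 1 ![s] ![1]

/-- A linear map whose residuals are orthogonal to its values is a contraction. -/
lemma norm_apply_le_of_inner_sub_apply_eq_zero {E : Type*} [NormedAddCommGroup E]
    [InnerProductSpace ℝ E] {Q : E →ₗ[ℝ] E} (hQ : ∀ f, ⟪f - Q f, Q f⟫ = 0) (f : E) :
    ‖Q f‖ ≤ ‖f‖ := by
  have h : ‖f‖ * ‖f‖ = ‖f - Q f‖ * ‖f - Q f‖ + ‖Q f‖ * ‖Q f‖ := by
    simpa using norm_add_sq_eq_norm_sq_add_norm_sq_of_inner_eq_zero _ _ (hQ f)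
  nlinarith [norm_nonneg (Q f), norm_nonneg f, mul_self_nonneg ‖f - Q f‖]

/-- Let `T ⊂ ℝ^d` be compact, `T₀ ⊂ T`, and `k` a `γ`-Hölder continuous
kernel on `T` that is universal on `T₀`, with `g|_{T₀}, μ|_{T₀} ∈ H(T₀)` (the RKHS `H(T₀)`
is realized abstractly by `H'`, `ev'`, `K'`; the restrictions `k_s|_{T₀}` by `KS`).  Let
`D = {t_n}` be countable dense in `T₀`, `Q N` the orthogonal projection in `H(T₀)` onto
`span{k_{t_1}|_{T₀}, …, k_{t_N}|_{T₀}}`, and let `X^N` be continuous-path Gaussian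
processes with means `μ₀^N(s) = μ(s) + ⟪Q_N k_s|_{T₀}, Q_N (g−μ)|_{T₀}⟫` and covariances
`k₀^N(s,t) = k(s,t) − ⟪Q_N k_s|_{T₀}, Q_N k_t|_{T₀}⟫`.  Then the family `{X^N}` is tight
in `(C(T), ‖·‖_∞)`. -/
theorem statement5 {d : ℕ} (T T₀ : Set (Euc d)) (hT : IsCompact T) (hT₀ : T₀ ⊆ T)
    (k : Euc d → Euc d → ℝ) (hk : IsKernelOn T k)
    (γ B : ℝ) (hγ : 0 < γ) (hB : 0 < B)
    (hHolder : ∀ s ∈ T, ∀ t ∈ T, ∀ s' ∈ T, ∀ t' ∈ T,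
      |k s t - k s' t'| ≤ B * (dist s s' ^ γ + dist t t' ^ γ))
    (hku : IsUniversalOn T₀ k)
    -- the RKHS H(T₀) of the restricted kernel
    (H' : Type) [NormedAddCommGroup H'] [InnerProductSpace ℝ H'] [CompleteSpace H']
    (ev' : H' →ₗ[ℝ] (↥T₀ → ℝ)) (hev' : Function.Injective ev')
    (K' : ↥T₀ → H')
    (hrepr' : ∀ (f : H') (t : ↥T₀), ⟪f, K' t⟫ = ev' f t)
    (hKk' : ∀ s t : ↥T₀, ev' (K' t) s = k ↑s ↑t)
    (hgen' : (Submodule.span ℝ (Set.range K')).topologicalClosure = ⊤)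
    -- the restrictions k_s|_{T₀} ∈ H(T₀) for s ∈ T
    (KS : ↥T → H')
    (hKS : ∀ (s : ↥T) (t : ↥T₀), ev' (KS s) t = k ↑t ↑s)
    (hKSincl : ∀ t : ↥T₀, KS (Set.inclusion hT₀ t) = K' t)
    (hKSnorm : ∀ s : ↥T, ‖KS s‖ ^ 2 ≤ k ↑s ↑s)
    (hKSdiff : ∀ s t : ↥T, ‖KS s - KS t‖ ^ 2 ≤ k ↑s ↑s - 2 * k ↑s ↑t + k ↑t ↑t)
    -- g and μ, with restrictions gr, mr to T₀ lying in H(T₀)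
    (g μ : Euc d → ℝ) (hμc : ContinuousOn μ T)
    (gr mr : H')
    (hgr : ∀ t : ↥T₀, ev' gr t = g ↑t) (hmr : ∀ t : ↥T₀, ev' mr t = μ ↑t)
    -- a countable dense subset of T₀ and the associated projections
    (D : ℕ → ↥T₀) (hD : DenseRange D)
    (Q : ℕ → H' →ₗ[ℝ] H')
    (hQmem : ∀ (N : ℕ) (f : H'),
      Q N f ∈ Submodule.span ℝ ((fun i => K' (D i)) '' Set.Iio N))
    (hQorth : ∀ (N : ℕ) (f h : H'),
      h ∈ Submodule.span ℝ ((fun i => K' (D i)) '' Set.Iio N) → ⟪f - Q N f, h⟫ = 0)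
    -- the continuous-path Gaussian processes X^N with means μ₀^N and covariances k₀^N
    (Ω : Type) [MeasurableSpace Ω] (P : Measure Ω) [IsProbabilityMeasure P]
    (X : ℕ → Ω → BoundedContinuousFunction ↥T ℝ)
    (hX : ∀ N : ℕ, IsGaussianProcess P (fun (t : ↥T) ω => X N ω t)
      (fun s : ↥T => μ ↑s + ⟪Q N (KS s), Q N (gr - mr)⟫)
      (fun s t : ↥T => k ↑s ↑t - ⟪Q N (KS s), Q N (KS t)⟫)) :
    -- tightness of {X^N} in (C(T), ‖·‖_∞)
    ∀ ε : ℝ, 0 < ε → ∃ C : Set (BoundedContinuousFunction ↥T ℝ),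
      IsCompact C ∧ ∀ N, ENNReal.ofReal (1 - ε) ≤ P {ω | X N ω ∈ C} := by
  intro ε hε
  have : CompactSpace T := isCompact_iff_compactSpace.1 hT
  obtain ⟨A, net, hcard, hnet⟩ := exists_dyadic_nets hT.isBounded
  have hQ : ∀ N f, ‖Q N f‖ ≤ ‖f‖ := fun N =>
    norm_apply_le_of_inner_sub_apply_eq_zero fun f => hQorth N f _ (hQmem N f)
  have hQinner : ∀ N a b, |⟪Q N a, Q N b⟫| ≤ ‖a‖ * ‖b‖ := fun N a b =>
    (abs_real_inner_le_norm _ _).trans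
      (mul_le_mul (hQ N a) (hQ N b) (norm_nonneg _) (norm_nonneg _))
  have hincr : ∀ s t : T, k s s - 2 * k s t + k t t ≤ 2 * B * dist s t ^ γ := by
    intro s t
    have h1 := le_of_abs_le (hHolder s s.2 s s.2 s s.2 t t.2)
    have h2 := le_of_abs_le (hHolder t t.2 t t.2 s s.2 t t.2)
    rw [dist_self, Real.zero_rpow hγ.ne'] at h1 h2
    rw [dist_comm] at h2
    rw [Subtype.dist_eq]
    linarith
  have hKSc : Continuous KS := by
    rw [continuous_iff_continuousAt]
    intro t
    rw [ContinuousAt, tendsto_iff_norm_sub_tendsto_zero]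
    have hlim : Filter.Tendsto (fun s => Real.sqrt (2 * B * dist s t ^ γ)) (nhds t) (nhds 0) := by
      have hc : Continuous fun s => Real.sqrt (2 * B * dist s t ^ γ) := by
        have := hγ.le
        fun_prop (disch := assumption)
      simpa [Real.zero_rpow hγ.ne'] using hc.tendsto t
    exact squeeze_zero (fun _ => norm_nonneg _)
      (fun s => Real.le_sqrt_of_sq_le ((hKSdiff s t).trans (hincr s t))) hlim
  have hμc' : Continuous fun s : T => μ s := continuousOn_iff_continuous_domRestrict.1 hμc
  have hdiag : Continuous fun s : T => k s s :=
    hk.1.comp_continuous (by fun_prop : Continuous fun s : T => ((s : Euc d), (s : Euc d)))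
      fun s => ⟨s.2, s.2⟩
  obtain ⟨M₁, hM₁⟩ := isCompact_univ.exists_bound_of_continuousOn hμc'.continuousOn
  obtain ⟨M₂, hM₂⟩ := isCompact_univ.exists_bound_of_continuousOn hKSc.continuousOn
  obtain ⟨V, hV⟩ := isCompact_univ.exists_bound_of_continuousOn hdiag.continuousOn
  have hmeans : UniformEquicontinuous fun (N : ℕ) (s : T) =>
      μ s + ⟪Q N (KS s), Q N (gr - mr)⟫ := by
    have huμ := Metric.uniformContinuous_iff.1
      (CompactSpace.uniformContinuous_of_continuous hμc')
    have huK := Metric.uniformContinuous_iff.1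
      (CompactSpace.uniformContinuous_of_continuous hKSc)
    rw [Metric.uniformEquicontinuous_iff]
    intro η hη
    have hpos : 0 < ‖gr - mr‖ + 1 := by positivity
    obtain ⟨δ₁, hδ₁, h₁⟩ := huμ (η / 2) (half_pos hη)
    obtain ⟨δ₂, hδ₂, h₂⟩ := huK (η / 2 / (‖gr - mr‖ + 1)) (by positivity)
    refine ⟨min δ₁ δ₂, lt_min hδ₁ hδ₂, fun s t hst N => ?_⟩
    have h3 := h₁ (hst.trans_le (min_le_left _ _))
    have h4 := h₂ (hst.trans_le (min_le_right _ _))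
    have h5 := hQinner N (KS s - KS t) (gr - mr)
    rw [dist_eq_norm, lt_div_iff₀ hpos] at h4
    rw [map_sub (Q N) (KS s), inner_sub_left] at h5
    rw [Real.dist_eq] at h3 ⊢
    have h6 : ‖KS s - KS t‖ * ‖gr - mr‖ < η / 2 :=
      lt_of_le_of_lt (by gcongr; linarith) h4
    rw [add_sub_add_comm]
    exact (abs_add_le _ _).trans_lt (by linarith)
  refine exists_isCompact_forall_ofReal_le_of_gaussian (S := T) (K := 2 * B) (V := |V| + 1)
    (M := M₁ + M₂ * ‖gr - mr‖) hcard hnet hmeans (fun N s => ?_) hγ (by positivity)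
    (by positivity) (fun N s => ⟨_, ?_, (hX N).map_eval s⟩)
    (fun N s t => ⟨_, ?_, (hX N).map_sub s t⟩) hε
  · refine (abs_add_le _ _).trans (add_le_add (hM₁ s trivial) ((hQinner N _ _).trans ?_))
    gcongr
    exact hM₂ s trivial
  · rw [Real.coe_toNNReal', max_le_iff]
    refine ⟨?_, by positivity⟩
    have h1 := le_of_abs_le (hV s trivial)
    have h2 := real_inner_self_nonneg (x := Q N (KS s))
    linarith [le_abs_self V]
  · rw [Real.coe_toNNReal', max_le_iff]
    refine ⟨?_, by positivity⟩
    have h1 := real_inner_self_nonneg (x := Q N (KS s - KS t))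
    rw [map_sub, inner_sub_left, inner_sub_right, inner_sub_right] at h1
    have h2 := hincr s t
    have h3 := hk.2.1 t t.2 s s.2
    linarith
end
end

section
/- Let T ⊂ ℝ^d be compact, T_0 ⊂ T, and let k be a γ-Hölder continuous kernel on T. Let {(λ_n, e_n)} be the eigenvalue–eigenfunction pairs of the integral operator K_{T_0} on L²(T_0) given by K_{T_0}x(t) = ∫_{T_0} k(s,t)x(s)ds, and define the bilinear forms a_N(f,g) = Σ_{n=1}^N ⟨f,e_n⟩_{L²(T_0)} ⟨g,e_n⟩_{L²(T_0)} / λ_n. Then the functions F_N(s,t) = a_N(k_s|_{T_0}, k_t|_{T_0}) converge uniformly on T × T to F(s,t) = ⟨k_s|_{T_0}, k_t|_{T_0}⟩_{H(T_0)}; i.e., the forms a_N converge uniformly to the RKHS inner product on the family {k_t|_{T_0} : t ∈ T}. -/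
open MeasureTheory Filter
open scoped BigOperators

noncomputable section

open scoped Topology RealInnerProductSpace

/-- Every positive semidefinite function admits a feature map into a Hilbert space. -/
theorem exists_featureMap {X : Type} (k : X → X → ℝ) (hsymm : ∀ s t, k s t = k t s)
    (hpos : ∀ (n : ℕ) (x : Fin n → X) (a : Fin n → ℝ),
      0 ≤ ∑ i, ∑ j, a i * a j * k (x i) (x j)) :
    ∃ (H : Type) (_ : NormedAddCommGroup H) (_ : InnerProductSpace ℝ H) (_ : CompleteSpace H)
      (φ : X → H), ∀ s t, ⟪φ s, φ t⟫ = k s t := by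
  let K : Matrix X X (ℝ →L[ℝ] ℝ) := Matrix.of fun s t => k s t • ContinuousLinearMap.id ℝ ℝ
  have hK : K.PosSemidef := by
    have hiff := (RKHS.posSemidef_tfae (K := K)).out 0 2
    refine hiff.mpr ⟨?_, fun v => ?_⟩
    · ext s t
      simp [K, hsymm s t, ContinuousLinearMap.star_eq_adjoint, ContinuousLinearMap.adjoint_id]
    · let x : Fin v.support.card → X := fun i => (v.support.equivFin.symm i : X)
      have h := hpos _ x fun i => v (x i)
      have hsum (g : X → ℝ) : ∑ i, g (x i) = ∑ y ∈ v.support, g y := by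
        rw [← Finset.sum_coe_sort v.support g]
        exact Equiv.sum_comp v.support.equivFin.symm fun y => g y
      rw [hsum fun y => ∑ j, v y * v (x j) * k y (x j)] at h
      simp_rw [fun y => hsum fun z => v y * v z * k y z] at h
      simp only [Finsupp.sum, RCLike.re_to_real]
      refine h.trans_eq <| Finset.sum_congr rfl fun y _ => Finset.sum_congr rfl fun z _ => ?_
      simp [K, hsymm z y]
      ring
  have : Fact K.PosSemidef := ⟨hK⟩
  refine ⟨RKHS.OfKernel K, inferInstance, inferInstance, inferInstance,
    fun x => RKHS.kerFun (RKHS.OfKernel K) x 1, fun s t => ?_⟩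
  rw [← RKHS.kernel_inner, RKHS.OfKernel.kernel_ofKernel]
  simp [K, hsymm t s]

section FeatureMap

variable {H : Type} [NormedAddCommGroup H] [InnerProductSpace ℝ H]

/-- A feature map of a continuous kernel is continuous. -/
theorem continuousOn_featureMap {X : Type*} [TopologicalSpace X] {T : Set X} {k : X → X → ℝ}
    (hk : ContinuousOn (fun p : X × X => k p.1 p.2) (T ×ˢ T)) {φ : X → H}
    (hφ : ∀ s ∈ T, ∀ t ∈ T, ⟪φ s, φ t⟫ = k s t) : ContinuousOn φ T := by
  intro t ht
  rw [ContinuousWithinAt, tendsto_iff_norm_sub_tendsto_zero]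
  have hd : Tendsto (fun s => k s s) (𝓝[T] t) (𝓝 (k t t)) :=
    (hk.comp (f := fun s => (s, s)) (by fun_prop) fun s hs => ⟨hs, hs⟩) t ht
  have ho : Tendsto (fun s => k s t) (𝓝[T] t) (𝓝 (k t t)) :=
    (hk.comp (f := fun s => (s, t)) (by fun_prop) fun s hs => ⟨hs, ht⟩) t ht
  have h0 : Tendsto (fun s => √(k s s - 2 * k s t + k t t)) (𝓝[T] t) (𝓝 0) := by
    have := ((hd.sub (ho.const_mul 2)).add_const (k t t)).sqrt
    rwa [show k t t - 2 * k t t + k t t = 0 by ring, Real.sqrt_zero] at this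
  refine h0.congr' ?_
  filter_upwards [self_mem_nhdsWithin] with s hs
  rw [← hφ s hs s hs, ← hφ s hs t ht, ← hφ t ht t ht, real_inner_self_eq_norm_sq,
    real_inner_self_eq_norm_sq, ← norm_sub_sq_real, Real.sqrt_sq (norm_nonneg _)]

/-- The partial sums of an orthonormal expansion are nonexpansive. -/
theorem Orthonormal.norm_sum_inner_smul_le {w : ℕ → H} (hw : Orthonormal ℝ w) (N : ℕ) (x : H) :
    ‖∑ n ∈ Finset.range N, ⟪w n, x⟫ • w n‖ ≤ ‖x‖ := by
  refine (sq_le_sq₀ (norm_nonneg _) (norm_nonneg _)).mp ?_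
  refine le_trans (le_of_eq ?_) (hw.sum_inner_products_le (s := Finset.range N) x)
  rw [← real_inner_self_eq_norm_sq, hw.inner_sum]
  exact Finset.sum_congr rfl fun n _ => by simp [sq]

/-- The partial sums of an orthonormal expansion converge uniformly on compact sets. -/
theorem Orthonormal.exists_tendstoUniformlyOn [CompleteSpace H] {w : ℕ → H}
    (hw : Orthonormal ℝ w) {K : Set H} (hK : IsCompact K) :
    ∃ P : H → H, TendstoUniformlyOn
      (fun N x => ∑ n ∈ Finset.range N, ⟪w n, x⟫ • w n) P atTop K := by
  have hsum (x : H) : Summable fun n => ⟪w n, x⟫ • w n := by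
    have := (hw.orthogonalFamily.summable_iff_norm_sq_summable fun n => ⟪w n, x⟫).mpr
      (hw.inner_products_summable x)
    simpa using this
  refine ⟨fun x => ∑' n, ⟪w n, x⟫ • w n, ?_⟩
  have hlip : UniformEquicontinuous fun (N : ℕ) (x : H) =>
      ∑ n ∈ Finset.range N, ⟪w n, x⟫ • w n := by
    refine LipschitzWith.uniformEquicontinuous _ 1 fun N => ?_
    refine LipschitzWith.of_dist_le_mul fun x y => ?_
    rw [dist_eq_norm, dist_eq_norm, ← Finset.sum_sub_distrib]
    simpa [← sub_smul, ← inner_sub_right] using hw.norm_sum_inner_smul_le N (x - y)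
  have := (EquicontinuousOn.tendsto_uniformOnFun_iff_pi' (𝔖 := {K}) (by simpa using hK)
    (by simpa using hlip.equicontinuous.equicontinuousOn K) atTop
    (fun x => ∑' n, ⟪w n, x⟫ • w n)).mpr
    (tendsto_pi_nhds.mpr fun x => (hsum x).hasSum.tendsto_sum_nat)
  exact (UniformOnFun.tendsto_iff_tendstoUniformlyOn.mp this) K rfl

/-- The truncations of the form `(x, y) ↦ ∑' n, ⟪w n, x⟫ * ⟪w n, y⟫` converge uniformly on
products of compact sets. -/
theorem Orthonormal.tendstoUniformlyOn_sum_inner_mul_inner [CompleteSpace H] {w : ℕ → H}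
    (hw : Orthonormal ℝ w) {K : Set H} (hK : IsCompact K) :
    TendstoUniformlyOn
      (fun (N : ℕ) (p : H × H) => ∑ n ∈ Finset.range N, ⟪w n, p.1⟫ * ⟪w n, p.2⟫)
      (fun p : H × H => ∑' n, ⟪w n, p.1⟫ * ⟪w n, p.2⟫) atTop (K ×ˢ K) := by
  obtain ⟨P, hP⟩ := hw.exists_tendstoUniformlyOn hK
  obtain ⟨C, hC⟩ := hK.isBounded.exists_norm_le
  have hform (N : ℕ) (x y : H) : ∑ n ∈ Finset.range N, ⟪w n, x⟫ * ⟪w n, y⟫ =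
      ⟪x, ∑ n ∈ Finset.range N, ⟪w n, y⟫ • w n⟫ := by
    rw [inner_sum]
    exact Finset.sum_congr rfl fun n _ => by
      rw [real_inner_smul_right, real_inner_comm x, mul_comm]
  have hlim (y : H) (hy : y ∈ K) (x : H) : ∑' n, ⟪w n, x⟫ * ⟪w n, y⟫ = ⟪x, P y⟫ := by
    have hs : Summable fun n => ⟪w n, x⟫ * ⟪w n, y⟫ := by
      refine Summable.of_norm_bounded
        ((hw.inner_products_summable x).add (hw.inner_products_summable y)) fun n => ?_
      rw [norm_mul]
      nlinarith [sq_nonneg (‖⟪w n, x⟫‖ - ‖⟪w n, y⟫‖), sq_nonneg ‖⟪w n, x⟫‖,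
        sq_nonneg ‖⟪w n, y⟫‖]
    refine tendsto_nhds_unique hs.hasSum.tendsto_sum_nat ?_
    simp_rw [hform]
    exact tendsto_const_nhds.inner (hP.tendsto_at hy)
  rw [Metric.tendstoUniformlyOn_iff] at hP ⊢
  intro ε hε
  have hC' : 0 < |C| + 1 := by positivity
  filter_upwards [hP (ε / (|C| + 1)) (by positivity)] with N hN p hp
  rw [hlim p.2 hp.2, hform, Real.dist_eq, ← inner_sub_right]
  have h1 := hN p.2 hp.2
  rw [dist_eq_norm, lt_div_iff₀ hC'] at h1
  have h2 : ‖p.1‖ ≤ |C| + 1 := (hC _ hp.1).trans ((le_abs_self C).trans (by linarith))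
  refine (abs_real_inner_le_norm _ _).trans_lt (lt_of_le_of_lt ?_ h1)
  rw [mul_comm]
  gcongr

end FeatureMap

/-- Points of `s` form a subset of full `μ.restrict s`-measure as far as null-measurable
properties are concerned, even when `s` is not measurable. -/
theorem ae_restrict_of_forall_mem₀ {α : Type*} [MeasurableSpace α] {μ : Measure α} {s : Set α}
    {p : α → Prop} (hp : NullMeasurableSet {x | p x} (μ.restrict s)) (h : ∀ x ∈ s, p x) :
    ∀ᵐ x ∂μ.restrict s, p x :=
  (ae_restrict_iff₀ hp).mpr (Eventually.of_forall h)

/-- An eigenfunction, on a possibly non-measurable set `T₀`, of an integral operator whose kernel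
is continuous and given by a feature map is almost everywhere measurable as soon as its square
is. -/
theorem aemeasurable_of_eigenfunction {X H : Type*} [TopologicalSpace X]
    [SecondCountableTopology X] [MeasurableSpace X] [OpensMeasurableSpace X]
    [NormedAddCommGroup H] [InnerProductSpace ℝ H] {μ : Measure X} {T T₀ : Set X}
    (hT : MeasurableSet T) (hT₀ : T₀ ⊆ T) {k : X → X → ℝ} {φ : X → H} (hcont : ContinuousOn φ T)
    (hφ : ∀ s ∈ T, ∀ t ∈ T, ⟪φ s, φ t⟫ = k s t) {l : ℝ} (hl : 0 < l) {f : X → ℝ}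
    (hsq : AEMeasurable (fun s => f s * f s) (μ.restrict T₀))
    (heig : ∀ t ∈ T₀, ∫ s in T₀, k s t * f s ∂μ = l * f t) :
    AEMeasurable f (μ.restrict T₀) := by
  have hmemT : ∀ᵐ u ∂μ.restrict T₀, u ∈ T :=
    ae_restrict_of_forall_mem₀ hT.nullMeasurableSet hT₀
  have hkc (t : X) (ht : t ∈ T) : ContinuousOn (fun u => k u t) T :=
    (hcont.inner continuousOn_const).congr fun u hu => (hφ u hu t ht).symm
  have hkm (t : X) (ht : t ∈ T) : AEMeasurable (fun u => k u t) (μ.restrict T₀) :=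
    ((hkc t ht).aemeasurable hT).mono_measure (Measure.restrict_mono hT₀ le_rfl)
  set A : Set X := {t | t ∈ T₀ ∧ f t ≠ 0}
  set V : X → Set X := fun t => {u | k u t ≠ 0}
  have hVm (t : X) (ht : t ∈ T) : NullMeasurableSet (V t) (μ.restrict T₀) :=
    (hkm t ht).nullMeasurable (measurableSet_singleton (0 : ℝ)).compl
  have hVf (t : X) (ht : t ∈ A) : AEMeasurable f ((μ.restrict T₀).restrict (V t)) := by
    have hint : Integrable (fun u => k u t * f u) (μ.restrict T₀) := by
      by_contra h
      have := heig t ht.1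
      rw [integral_undef h] at this
      exact (mul_ne_zero hl.ne' ht.2) this.symm
    have hdiv := (hint.aemeasurable.div (hkm t (hT₀ ht.1))).mono_measure
      (Measure.restrict_le_self (s := V t))
    refine hdiv.congr ?_
    refine (ae_restrict_iff'₀ (hVm t (hT₀ ht.1))).mpr (Eventually.of_forall fun u hu => ?_)
    exact mul_div_cancel_left₀ (f u) hu
  have hVn (t : X) (ht : t ∈ A) : V t ∈ 𝓝[A] t := by
    have htT := hT₀ ht.1
    have hne : k t t ≠ 0 := by
      intro h
      rw [← hφ t htT t htT, inner_self_eq_zero] at h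
      have h0 : ∫ s in T₀, k s t * f s ∂μ = 0 := by
        refine integral_eq_zero_of_ae ?_
        filter_upwards [hmemT] with u hu
        simp [← hφ u hu t htT, h]
      rw [heig t ht.1] at h0
      exact (mul_ne_zero hl.ne' ht.2) h0
    exact nhdsWithin_mono t (fun u hu => hT₀ hu.1)
      ((hkc t htT t htT).eventually_ne hne)
  obtain ⟨C, hCA, hCc, hAC⟩ := TopologicalSpace.countable_cover_nhdsWithin hVn
  have : Countable C := hCc
  rw [Set.biUnion_eq_iUnion] at hAC
  set U : Set X := ⋃ t : C, V t
  have hU : NullMeasurableSet U (μ.restrict T₀) :=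
    NullMeasurableSet.iUnion fun t => hVm t (hT₀ (hCA t.2).1)
  have hfU : AEMeasurable f ((μ.restrict T₀).restrict U) :=
    aemeasurable_iUnion_iff.mpr fun t => hVf t (hCA t.2)
  have hfUc : AEMeasurable f ((μ.restrict T₀).restrict Uᶜ) := by
    refine (aemeasurable_const (b := (0 : ℝ))).congr ?_
    refine (ae_restrict_iff'₀ hU.compl).mpr ?_
    have hp : NullMeasurableSet {u | u ∈ U ∨ f u * f u = 0} (μ.restrict T₀) :=
      hU.union (hsq.nullMeasurable (measurableSet_singleton (0 : ℝ)))
    filter_upwards [ae_restrict_of_forall_mem₀ hp fun u hu => by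
      by_cases h : f u = 0
      · simp [h]
      · exact Or.inl (hAC ⟨hu, h⟩)] with u hu huc
    simpa [eq_comm] using hu.resolve_left huc
  have := aemeasurable_union_iff.mpr ⟨hfU, hfUc⟩
  rwa [Set.union_compl_self, Measure.restrict_univ] at this

/-- Let `T ⊂ ℝ^d` be compact, `T₀ ⊂ T`, and `k` a `γ`-Hölder continuous
kernel on `T`.  Let `{(λ_n, e_n)}` be the eigenpairs of the integral operator on `L²(T₀)`
with kernel `k`, and let `a_N(f,g) = Σ_{n<N} ⟨f,e_n⟩⟨g,e_n⟩/λ_n` be the truncated bilinear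
forms.  By Mercer's theorem, `⟨k_s|_{T₀}, k_t|_{T₀}⟩_{H(T₀)} = Σ_n ⟨k_s,e_n⟩⟨k_t,e_n⟩/λ_n`.
Then `F_N(s,t) = a_N(k_s|_{T₀}, k_t|_{T₀})` converges uniformly on `T × T` to
`F(s,t) = ⟨k_s|_{T₀}, k_t|_{T₀}⟩_{H(T₀)}`. -/
theorem statement7 {d : ℕ} (T T₀ : Set (Euc d)) (hT : IsCompact T) (hT₀ : T₀ ⊆ T)
    (k : Euc d → Euc d → ℝ) (hk : IsKernelOn T k)
    (γ B : ℝ) (hγ : 0 < γ) (hB : 0 < B)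
    (hHolder : ∀ s ∈ T, ∀ t ∈ T, ∀ s' ∈ T, ∀ t' ∈ T,
      |k s t - k s' t'| ≤ B * (dist s s' ^ γ + dist t t' ^ γ))
    (lam : ℕ → ℝ) (hlam : ∀ n, 0 < lam n)
    (e : ℕ → Euc d → ℝ)
    (horth : ∀ n m : ℕ, (∫ s in T₀, e n s * e m s) = if n = m then (1 : ℝ) else 0)
    (heig : ∀ n : ℕ, ∀ t ∈ T₀, (∫ s in T₀, k s t * e n s) = lam n * e n t)
    (hMercer : ∀ s ∈ T₀, ∀ t ∈ T₀, k s t = ∑' n, lam n * e n s * e n t)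
    (hsum : ∀ s ∈ T, ∀ t ∈ T, Summable fun n =>
      (∫ u in T₀, k u s * e n u) * (∫ u in T₀, k u t * e n u) / lam n) :
    TendstoUniformlyOn
      (fun (N : ℕ) (p : Euc d × Euc d) => ∑ n ∈ Finset.range N,
        (∫ u in T₀, k u p.1 * e n u) * (∫ u in T₀, k u p.2 * e n u) / lam n)
      (fun p : Euc d × Euc d =>
        ∑' n, (∫ u in T₀, k u p.1 * e n u) * (∫ u in T₀, k u p.2 * e n u) / lam n)
      atTop (T ×ˢ T) := by
  have hTm : MeasurableSet T := hT.measurableSet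
  obtain ⟨H, _, _, _, φ₀, hφ₀⟩ := exists_featureMap (fun s t : T => k s t)
    (fun s t => hk.2.1 s s.2 t t.2)
    (fun n x a => hk.2.2 n (fun i => x i) (fun i => (x i).2) a)
  classical
  let φ : Euc d → H := fun u => if h : u ∈ T then φ₀ ⟨u, h⟩ else 0
  have hφ : ∀ s ∈ T, ∀ t ∈ T, ⟪φ s, φ t⟫ = k s t := fun s hs t ht => by
    simp [φ, hs, ht, hφ₀]
  have hcont : ContinuousOn φ T := continuousOn_featureMap hk.1 hφ
  have hvol : volume T₀ < ⊤ := (measure_mono hT₀).trans_lt hT.measure_lt_top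
  have : IsFiniteMeasure (volume.restrict T₀) := ⟨by simpa using hvol⟩
  have hmemT : ∀ᵐ u ∂volume.restrict T₀, u ∈ T :=
    ae_restrict_of_forall_mem₀ hTm.nullMeasurableSet hT₀
  have hφm : AEStronglyMeasurable φ (volume.restrict T₀) :=
    (hcont.aestronglyMeasurable_of_isCompact hT hTm).mono_measure
      (Measure.restrict_mono hT₀ le_rfl)
  obtain ⟨C, hC⟩ := (hT.image_of_continuousOn hcont).isBounded.exists_norm_le
  have hesq (n : ℕ) : Integrable (fun s => e n s * e n s) (volume.restrict T₀) := by
    by_contra h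
    have := horth n n
    simp [integral_undef h] at this
  have hem (n : ℕ) : AEMeasurable (e n) (volume.restrict T₀) :=
    aemeasurable_of_eigenfunction hTm hT₀ hcont hφ (hlam n) (hesq n).aemeasurable (heig n)
  have he (n : ℕ) : Integrable (e n) (volume.restrict T₀) := by
    have : MemLp (e n) 2 (volume.restrict T₀) :=
      (memLp_two_iff_integrable_sq (hem n).aestronglyMeasurable).mpr
        (by simpa only [sq] using hesq n)
    exact this.integrable (by norm_num)
  have heφ (n : ℕ) : Integrable (fun u => e n u • φ u) (volume.restrict T₀) :=
    (he n).smul_bdd C hφm (hmemT.mono fun u hu => hC _ (Set.mem_image_of_mem φ hu))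
  let v : ℕ → H := fun n => ∫ u in T₀, e n u • φ u
  have hvy (n : ℕ) (y : H) : ⟪v n, y⟫ = ∫ u in T₀, e n u * ⟪φ u, y⟫ := by
    rw [real_inner_comm, ← integral_inner (heφ n)]
    refine integral_congr_ae (Eventually.of_forall fun u => ?_)
    simp [real_inner_smul_right, real_inner_comm y]
  have hc (n : ℕ) (t : Euc d) (ht : t ∈ T) : ∫ u in T₀, k u t * e n u = ⟪v n, φ t⟫ := by
    rw [hvy]
    refine integral_congr_ae ?_
    filter_upwards [hmemT] with u hu
    rw [hφ u hu t ht, mul_comm]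
  have hceig (n : ℕ) : ∀ᵐ u ∂volume.restrict T₀, ⟪v n, φ u⟫ = lam n * e n u :=
    ae_restrict_of_forall_mem₀
      (nullMeasurableSet_eq_fun (aestronglyMeasurable_const.inner hφm).aemeasurable
        ((hem n).const_mul _))
      fun t ht => by rw [← hc n t (hT₀ ht), heig n t ht]
  have hvv (n m : ℕ) : ⟪v n, v m⟫ = if n = m then lam m else 0 := by
    have : ⟪v n, v m⟫ = ∫ u in T₀, lam m * (e n u * e m u) := by
      rw [hvy]
      refine integral_congr_ae ?_
      filter_upwards [hceig m] with u hu
      rw [real_inner_comm, hu]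
      ring
    rw [this, integral_const_mul, horth]
    simp
  let w : ℕ → H := fun n => (√(lam n))⁻¹ • v n
  have hw : Orthonormal ℝ w := by
    rw [orthonormal_iff_ite]
    intro n m
    simp only [w, real_inner_smul_left, real_inner_smul_right, hvv]
    split_ifs with h
    · subst h
      have h1 := (Real.sqrt_pos.mpr (hlam n)).ne'
      field_simp
      exact (Real.sq_sqrt (hlam n).le).symm
    · simp
  have hterm (n : ℕ) (p : Euc d × Euc d) (hp : p ∈ T ×ˢ T) :
      (∫ u in T₀, k u p.1 * e n u) * (∫ u in T₀, k u p.2 * e n u) / lam n =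
        ⟪w n, φ p.1⟫ * ⟪w n, φ p.2⟫ := by
    rw [hc n _ hp.1, hc n _ hp.2]
    simp only [w, real_inner_smul_left]
    rw [mul_mul_mul_comm, ← mul_inv, Real.mul_self_sqrt (hlam n).le, div_eq_inv_mul]
  have hunif := (hw.tendstoUniformlyOn_sum_inner_mul_inner
    (hT.image_of_continuousOn hcont)).comp fun p : Euc d × Euc d => (φ p.1, φ p.2)
  refine ((hunif.mono fun p hp =>
    ⟨Set.mem_image_of_mem φ hp.1, Set.mem_image_of_mem φ hp.2⟩).congr
      (Eventually.of_forall fun N p hp => ?_)).congr_right fun p hp => ?_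
  · exact Finset.sum_congr rfl fun n _ => (hterm n p hp).symm
  · exact tsum_congr fun n => (hterm n p hp).symm
end
end

section
/- Let T ⊂ ℝ^d be compact and bounded, T_0 ⊂ T, and let k be a γ-Hölder continuous kernel on T. With Q_N the orthogonal projection of H(T_0) onto span{k_{t_1}|_{T_0}, ..., k_{t_N}|_{T_0}} for a countable dense D = {t_n} ⊂ T_0, define k_0^N(s,t) = k(s,t) − ⟨Q_N(k_s|_{T_0}), Q_N(k_t|_{T_0})⟩_{H(T_0)}. Then there exists a constant C̃ > 0, independent of N and of s_0, such that for all s_0, s, t ∈ T, |k_0^N(s_0,s) − k_0^N(s_0,t)| ≤ C̃ |s − t|^{γ/2}; that is, the kernels k_0^N are γ/2-Hölder continuous uniformly in N. -/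
open scoped BigOperators RealInnerProductSpace

noncomputable section

/-- If `f - p` is orthogonal to `p`, then `p` is no longer than `f`. -/
lemma norm_le_of_inner_sub_self_eq_zero {E : Type*} [NormedAddCommGroup E]
    [InnerProductSpace ℝ E] {f p : E} (h : ⟪f - p, p⟫ = 0) : ‖p‖ ≤ ‖f‖ := by
  have hpyth := norm_add_sq_eq_norm_sq_add_norm_sq_of_inner_eq_zero (f - p) p h
  rw [sub_add_cancel] at hpyth
  nlinarith [norm_nonneg f, norm_nonneg p, mul_self_nonneg ‖f - p‖]

/-- Let `T ⊂ ℝ^d` be compact (hence bounded), `T₀ ⊂ T`, and `k` a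
`γ`-Hölder continuous kernel on `T`.  With `Q_N` the orthogonal projection of `H(T₀)`
(realized by `H'`, `ev'`, `K'`; restrictions `k_s|_{T₀}` realized by `KS`, with
`‖k_s|_{T₀}‖ ≤ ‖k_s‖_{H(T)}` and `‖k_s|_{T₀} − k_t|_{T₀}‖ ≤ ‖k_s − k_t‖_{H(T)}`) onto
`span{k_{t_1}|_{T₀}, …, k_{t_N}|_{T₀}}` for a countable dense `D ⊂ T₀`, define
`k₀^N(s,t) = k(s,t) − ⟪Q_N k_s|_{T₀}, Q_N k_t|_{T₀}⟫`.  Then there is a constant `C̃ > 0`,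
independent of `N` and of `s₀`, with
`|k₀^N(s₀,s) − k₀^N(s₀,t)| ≤ C̃|s−t|^{γ/2}` for all `s₀, s, t ∈ T`:
the kernels `k₀^N` are `γ/2`-Hölder continuous uniformly in `N`. -/
theorem statement17 {d : ℕ} (T T₀ : Set (Euc d)) (hT : IsCompact T) (hT₀ : T₀ ⊆ T)
    (k : Euc d → Euc d → ℝ) (hk : IsKernelOn T k)
    (γ B : ℝ) (hγ : 0 < γ) (hB : 0 < B)
    (hHolder : ∀ s ∈ T, ∀ t ∈ T, ∀ s' ∈ T, ∀ t' ∈ T,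
      |k s t - k s' t'| ≤ B * (dist s s' ^ γ + dist t t' ^ γ))
    -- the RKHS H(T₀) of the restricted kernel
    (H' : Type) [NormedAddCommGroup H'] [InnerProductSpace ℝ H'] [CompleteSpace H']
    (ev' : H' →ₗ[ℝ] (↥T₀ → ℝ)) (hev' : Function.Injective ev')
    (K' : ↥T₀ → H')
    (hrepr' : ∀ (f : H') (t : ↥T₀), ⟪f, K' t⟫ = ev' f t)
    (hKk' : ∀ s t : ↥T₀, ev' (K' t) s = k ↑s ↑t)
    (hgen' : (Submodule.span ℝ (Set.range K')).topologicalClosure = ⊤)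
    -- the restrictions k_s|_{T₀} ∈ H(T₀) for s ∈ T, with the restriction-norm bounds
    (KS : ↥T → H')
    (hKS : ∀ (s : ↥T) (t : ↥T₀), ev' (KS s) t = k ↑t ↑s)
    (hKSincl : ∀ t : ↥T₀, KS (Set.inclusion hT₀ t) = K' t)
    (hKSnorm : ∀ s : ↥T, ‖KS s‖ ^ 2 ≤ k ↑s ↑s)
    (hKSdiff : ∀ s t : ↥T, ‖KS s - KS t‖ ^ 2 ≤ k ↑s ↑s - 2 * k ↑s ↑t + k ↑t ↑t)
    -- a countable dense subset D of T₀ and the projections Q_N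
    (D : ℕ → ↥T₀) (hD : DenseRange D)
    (Q : ℕ → H' →ₗ[ℝ] H')
    (hQmem : ∀ (N : ℕ) (f : H'),
      Q N f ∈ Submodule.span ℝ ((fun i => K' (D i)) '' Set.Iio N))
    (hQorth : ∀ (N : ℕ) (f h : H'),
      h ∈ Submodule.span ℝ ((fun i => K' (D i)) '' Set.Iio N) → ⟪f - Q N f, h⟫ = 0) :
    ∃ C : ℝ, 0 < C ∧ ∀ (N : ℕ) (s₀ s t : ↥T),
      |(k ↑s₀ ↑s - ⟪Q N (KS s₀), Q N (KS s)⟫) -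
        (k ↑s₀ ↑t - ⟪Q N (KS s₀), Q N (KS t)⟫)| ≤
      C * dist (s : Euc d) (t : Euc d) ^ (γ / 2) := by
  obtain ⟨M, hM⟩ := hT.exists_bound_of_continuousOn
    (hk.1.comp (f := fun s : Euc d => (s, s)) (by fun_prop) fun s hs => ⟨hs, hs⟩)
  have hQ (N : ℕ) (f : H') : ‖Q N f‖ ≤ ‖f‖ :=
    norm_le_of_inner_sub_self_eq_zero (hQorth N f _ (hQmem N f))
  have hdiag (s t : ↥T) (u : ↥T) : |k ↑u ↑s - k ↑u ↑t| ≤ B * dist (s : Euc d) t ^ γ := by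
    simpa [Real.zero_rpow hγ.ne'] using hHolder u u.2 s s.2 u u.2 t t.2
  refine ⟨B * Metric.diam T ^ (γ / 2) + √M * √(2 * B) + 1, by positivity, fun N s₀ s t => ?_⟩
  set r := dist (s : Euc d) (t : Euc d)
  have hr0 : 0 ≤ r := dist_nonneg
  have hsplit : r ^ γ = r ^ (γ / 2) * r ^ (γ / 2) := by
    rw [← Real.rpow_add_of_nonneg hr0 (by positivity) (by positivity), add_halves]
  have hkernel : |k ↑s₀ ↑s - k ↑s₀ ↑t| ≤ B * Metric.diam T ^ (γ / 2) * r ^ (γ / 2) := by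
    have hdiam : r ≤ Metric.diam T := Metric.dist_le_diam_of_mem hT.isBounded s.2 t.2
    calc |k ↑s₀ ↑s - k ↑s₀ ↑t| ≤ B * (r ^ (γ / 2) * r ^ (γ / 2)) := hsplit ▸ hdiag s t s₀
      _ ≤ B * (Metric.diam T ^ (γ / 2) * r ^ (γ / 2)) := by gcongr
      _ = _ := by ring
  have hnorm : ‖KS s₀‖ ≤ √M :=
    Real.le_sqrt_of_sq_le <| (hKSnorm s₀).trans <| (le_abs_self _).trans (hM s₀ s₀.2)
  have hdiff : ‖KS s - KS t‖ ≤ √(2 * B) * r ^ (γ / 2) := by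
    refine abs_le_of_sq_le_sq' ?_ (by positivity) |>.2
    rw [mul_pow, Real.sq_sqrt (by positivity), sq (r ^ _), ← hsplit]
    have h₁ := (le_abs_self _).trans (hdiag s t s)
    have h₂ := (neg_le_abs _).trans (hdiag s t t)
    have h₃ := hk.2.1 t t.2 s s.2
    linarith [hKSdiff s t]
  have hinner : |⟪Q N (KS s₀), Q N (KS s - KS t)⟫| ≤ √M * √(2 * B) * r ^ (γ / 2) :=
    calc |⟪Q N (KS s₀), Q N (KS s - KS t)⟫|
        ≤ ‖Q N (KS s₀)‖ * ‖Q N (KS s - KS t)‖ := abs_real_inner_le_norm _ _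
      _ ≤ √M * (√(2 * B) * r ^ (γ / 2)) := by
        gcongr
        exacts [(hQ _ _).trans hnorm, (hQ _ _).trans hdiff]
      _ = _ := by ring
  calc _ = |(k ↑s₀ ↑s - k ↑s₀ ↑t) - ⟪Q N (KS s₀), Q N (KS s - KS t)⟫| := by
        rw [map_sub, inner_sub_right]
        congr 1
        ring
    _ ≤ |k ↑s₀ ↑s - k ↑s₀ ↑t| + |⟪Q N (KS s₀), Q N (KS s - KS t)⟫| := abs_sub _ _
    _ ≤ _ := by linarith [Real.rpow_nonneg hr0 (γ / 2)]
end
end
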